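/- For every integer n ≥ 2 and all indices with 1 ≤ j ≤ i ≤ n−1, 1 ≤ l ≤ k ≤ n−1, i ≥ l and |k−j| = 1, the equation h^{[i,j]} h^{[k,l]} = h^{[i,l]} holds in the Kauffman monoid K_n. -/

import Mathlib

/-!
Kauffman monoid `K n` for `n ≥ 2`: presented by generators `h^1, …, h^{n-1}`
(diapsides) and `c` (circle), subject to
`h^i h^j = h^j h^i` for `|i-j| ≥ 2`, `h^i h^{i±1} h^i = h^i`,
`h^i c = c h^i`, `h^i h^i = c h^i`.
-/

namespace Kauffman

/-- Valid diapsis indices `1 ≤ i ≤ n-1`. -/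
def Idx (n : ℕ) : Type := {i : ℕ // 1 ≤ i ∧ i ≤ n - 1}

/-- Generators of the Kauffman monoid. -/
inductive Gen (n : ℕ) : Type
  | h : Idx n → Gen n
  | c : Gen n

/-- The defining relations of the Kauffman monoid. -/
inductive Rel (n : ℕ) : FreeMonoid (Gen n) → FreeMonoid (Gen n) → Prop
  | comm (i j : Idx n) (hij : i.1 + 2 ≤ j.1 ∨ j.1 + 2 ≤ i.1) :
      Rel n (FreeMonoid.of (Gen.h i) * FreeMonoid.of (Gen.h j))
            (FreeMonoid.of (Gen.h j) * FreeMonoid.of (Gen.h i))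
  | absorb (i j : Idx n) (hij : j.1 = i.1 + 1 ∨ i.1 = j.1 + 1) :
      Rel n (FreeMonoid.of (Gen.h i) * FreeMonoid.of (Gen.h j) * FreeMonoid.of (Gen.h i))
            (FreeMonoid.of (Gen.h i))
  | hc (i : Idx n) :
      Rel n (FreeMonoid.of (Gen.h i) * FreeMonoid.of Gen.c)
            (FreeMonoid.of Gen.c * FreeMonoid.of (Gen.h i))
  | hh (i : Idx n) :
      Rel n (FreeMonoid.of (Gen.h i) * FreeMonoid.of (Gen.h i))
            (FreeMonoid.of Gen.c * FreeMonoid.of (Gen.h i))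

/-- The congruence generated by the Kauffman relations. -/
def kcon (n : ℕ) : Con (FreeMonoid (Gen n)) := conGen (Rel n)

/-- The Kauffman monoid `K n`. -/
abbrev K (n : ℕ) : Type := (kcon n).Quotient

/-- The diapsis `h^i` as an element of `K n` (defined to be `1` for out-of-range `i`). -/
def hK (n i : ℕ) : K n :=
  if h : 1 ≤ i ∧ i ≤ n - 1 then ((FreeMonoid.of (Gen.h ⟨i, h⟩) : FreeMonoid (Gen n)) : K n)
  else 1

/-- The circle `c` as an element of `K n`. -/
def cK (n : ℕ) : K n := ((FreeMonoid.of Gen.c : FreeMonoid (Gen n)) : K n)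

/-- The block `h^{[i,j]} = h^i h^{i-1} ⋯ h^{j+1} h^j` (for `j ≤ i`). -/
def block (n i j : ℕ) : K n :=
  (((List.range (i + 1 - j)).map fun t => hK n (i - t))).prod

end Kauffman

namespace Kauffman

theorem block_self (n i : ℕ) : block n i i = hK n i := by
  simp [block]

/-- Adjacent blocks concatenate. -/
theorem block_mul_block (n : ℕ) {i m j : ℕ} (hmi : m ≤ i) (hjm : j ≤ m + 1) :
    block n i (m + 1) * block n m j = block n i j := by
  have hlen : i + 1 - j = (i + 1 - (m + 1)) + (m + 1 - j) := by omega
  unfold block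
  rw [hlen, List.range_add, List.map_append, List.prod_append, List.map_map]
  congr 3
  funext t
  simp only [Function.comp_apply]
  congr 1
  omega

/-- The relation `h^i h^{i±1} h^i = h^i` in `K n`. -/
theorem hK_mul_hK_mul_hK {n i j : ℕ} (hi : 1 ≤ i ∧ i ≤ n - 1) (hj : 1 ≤ j ∧ j ≤ n - 1)
    (hij : j = i + 1 ∨ i = j + 1) : hK n i * hK n j * hK n i = hK n i := by
  simp only [hK, dif_pos hi, dif_pos hj]
  exact (Con.eq (kcon n)).2 (ConGen.Rel.of _ _ (Rel.absorb ⟨i, hi⟩ ⟨j, hj⟩ hij))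

/-- A block starting at `i` splits off its first letter. -/
theorem block_eq_hK_mul_block (n : ℕ) {m j : ℕ} (hjm : j ≤ m + 1) :
    block n (m + 1) j = hK n (m + 1) * block n m j := by
  rw [← block_mul_block n (Nat.le_succ m) hjm, block_self]

/-- A block ending at `j` splits off its last letter. -/
theorem block_eq_block_mul_hK (n : ℕ) {i j : ℕ} (hji : j ≤ i) :
    block n i j = block n i (j + 1) * hK n j := by
  rw [← block_mul_block n hji (Nat.le_succ j), block_self]

end Kauffman

open Kauffman in
/-- `(h II)`: for `i ≥ l` and `|k - j| = 1`,
`h^{[i,j]} h^{[k,l]} = h^{[i,l]}` in `K n`. -/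
theorem kauffman_block_absorb (n i j k l : ℕ) (hn : 2 ≤ n)
    (hj : 1 ≤ j) (hji : j ≤ i) (hi : i ≤ n - 1)
    (hl : 1 ≤ l) (hlk : l ≤ k) (hk : k ≤ n - 1)
    (hil : l ≤ i) (hkj : k = j + 1 ∨ j = k + 1) :
    block n i j * block n k l = block n i l := by
  rcases hkj with rfl | rfl
  · rcases Nat.lt_or_ge j l with hjl | hlj
    · obtain rfl : l = j + 1 := by omega
      rw [block_self, block_eq_block_mul_hK n hji, block_eq_block_mul_hK n hil, mul_assoc,
        mul_assoc, ← mul_assoc (hK n (j + 1)),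
        hK_mul_hK_mul_hK (by omega) (by omega) (Or.inr rfl)]
    · obtain ⟨m, rfl⟩ : ∃ m, j = m + 1 := ⟨j - 1, by omega⟩
      rw [block_eq_block_mul_hK n hji, block_eq_hK_mul_block n hlk, block_eq_hK_mul_block n hlj,
        mul_assoc, ← mul_assoc (hK n (m + 1 + 1)), ← mul_assoc (hK n (m + 1)),
        ← mul_assoc (hK n (m + 1)), hK_mul_hK_mul_hK (by omega) (by omega) (Or.inl rfl),
        ← block_eq_hK_mul_block n hlj, block_mul_block n hji (by omega)]
  · exact block_mul_block n (by omega) (by omega)
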